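/- arXiv:1702.01073 — 3 statements merged into one kernel-verified Lean document; each statement's English description precedes it below -/
import Mathlib

section
/- Let F₁ be a finite-dimensional C*-algebra, let F₂ = M_{r₁} ⊕ ⋯ ⊕ M_{r_k} be a direct sum of complex matrix algebras, let φ₀, φ₁ : F₁ → F₂ be *-homomorphisms, and let B = A(F₁, F₂, φ₀, φ₁) be the Elliott–Thomsen building block. Let (h, a) ∈ B be a positive element; write h_j ∈ C([0,1], M_{r_j}) for the j-th component of h, and let P_j(t) ∈ M_{r_j} denote the range projection of h_j(t). Suppose that for each j there is a partition 0 = t_j⁰ < t_j¹ < ⋯ < t_j^{n_j} = 1 such that: (1) on each open interval (t_j^l, t_j^{l+1}) the map t ↦ P_j(t) is continuous and P_j(t) has constant rank; (2) at each partition point t_j^l the one-sided limits P_j((t_j^l)⁺) = lim_{t→(t_j^l)⁺} P_j(t) (if t_j^l < 1) and P_j((t_j^l)⁻) = lim_{t→(t_j^l)⁻} P_j(t) (if t_j^l > 0) exist; (3) P_j(t_j^l) ≤ P_j((t_j^l)⁺) and P_j(t_j^l) ≤ P_j((t_j^l)⁻) whenever these limits are defined; (4) π^j(φ₀(p)) =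 P_j(0) = P_j(0⁺) and π^j(φ₁(p)) = P_j(1) = P_j(1⁻), where p ∈ F₁ is the range projection of a and π^j : F₂ → M_{r_j} is the j-th coordinate projection. Then the hereditary C*-subalgebra closure((h,a)·B·(h,a)) is *-isomorphic to an Elliott–Thomsen building block A(E₁, E₂, ψ₀, ψ₁) for some finite-dimensional C*-algebras E₁, E₂ and *-homomorphisms ψ₀, ψ₁ : E₁ → E₂. -/
open unitInterval

set_option maxHeartbeats 1000000
set_option synthInstance.maxHeartbeats 400000

noncomputable section

/-- The full matrix algebra `M_r(ℂ)`, realized as the C⋆-algebra of operators on the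
`r`-dimensional complex Hilbert space. -/
abbrev MatAlg (r : ℕ) : Type :=
  EuclideanSpace ℂ (Fin r) →L[ℂ] EuclideanSpace ℂ (Fin r)

/-- The rank of an element of `M_r(ℂ)`. -/
def matRank {r : ℕ} (T : MatAlg r) : ℕ :=
  Module.finrank ℂ (LinearMap.range (T : EuclideanSpace ℂ (Fin r) →ₗ[ℂ] EuclideanSpace ℂ (Fin r)))

/-- `p` is the range projection of the positive element `x`: `p` is a projection with `p x = x`
which is dominated by every projection `q` with `q x = x` (equivalently, `p` is the spectral
projection of `x` corresponding to the nonzero part of the spectrum). -/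
def IsRangeProjection {M : Type*} [NonUnitalSemiring M] [StarRing M] (x p : M) : Prop :=
  IsSelfAdjoint p ∧ p * p = p ∧ p * x = x ∧
    ∀ q : M, IsSelfAdjoint q → q * q = q → q * x = x → p * q = p

/-- The Elliott–Thomsen building block `A(F₁, F₂, φ₀, φ₁)`, as a (non-unital, star, closed)
subalgebra of `C([0,1], F₂) ⊕ F₁`. -/
def ETBlockSubalg (F₁ F₂ : Type) [CStarAlgebra F₁] [CStarAlgebra F₂]
    (φ₀ φ₁ : F₁ →⋆ₙₐ[ℂ] F₂) : NonUnitalStarSubalgebra ℂ (C(I, F₂) × F₁) where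
  carrier := {p | p.1 0 = φ₀ p.2 ∧ p.1 1 = φ₁ p.2}
  add_mem' := by
    rintro a b ⟨ha0, ha1⟩ ⟨hb0, hb1⟩
    constructor <;> simp_all
  mul_mem' := by
    rintro a b ⟨ha0, ha1⟩ ⟨hb0, hb1⟩
    constructor <;> simp_all
  smul_mem' := by
    rintro c a ⟨ha0, ha1⟩
    constructor <;> simp_all
  star_mem' := by
    rintro a ⟨ha0, ha1⟩
    constructor <;> simp_all [map_star]
  zero_mem' := by simp

/-- The hereditary C⋆-subalgebra `closure (e B e)` of a selfadjoint element `e` of a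
(non-unital, star) subalgebra `B` of a C⋆-algebra `E`. -/
def heredSubalg {E : Type*} [NonUnitalCStarAlgebra E] (B : NonUnitalStarSubalgebra ℂ E)
    (e : E) (heB : e ∈ B) (hse : star e = e) : NonUnitalStarSubalgebra ℂ E :=
  NonUnitalStarSubalgebra.topologicalClosure
    { carrier := {x | ∃ b ∈ B, x = e * b * e}
      add_mem' := by
        rintro x y ⟨b, hb, rfl⟩ ⟨c, hc, rfl⟩
        exact ⟨b + c, add_mem hb hc, by noncomm_ring⟩
      mul_mem' := by
        rintro x y ⟨b, hb, rfl⟩ ⟨c, hc, rfl⟩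
        exact ⟨b * (e * e) * c, mul_mem (mul_mem hb (mul_mem heB heB)) hc, by noncomm_ring⟩
      smul_mem' := by
        rintro c x ⟨b, hb, rfl⟩
        exact ⟨c • b, SMulMemClass.smul_mem c hb, by rw [mul_smul_comm, smul_mul_assoc]⟩
      star_mem' := by
        rintro x ⟨b, hb, rfl⟩
        exact ⟨star b, star_mem hb, by simp [star_mul, hse, mul_assoc]⟩
      zero_mem' := ⟨0, zero_mem _, by simp⟩ }

/-- The conditions (1)–(4) on the range projections `P j` of the components of an element of a
building block, relative to partitions `0 = t 0 < t 1 < ⋯ < t (m+1) = 1` of `[0,1]`: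
(1) on each open subinterval `P j` is continuous of constant rank; (2) one-sided limits
`Pp l` (from the right) and `Pm l` (from the left) exist at the partition points;
(3) `P j (t l)` is dominated by these one-sided limits; (4) at the endpoints, `P j` agrees with
the `j`-th components `p0 j`, `p1 j` of the boundary projections and with the corresponding
one-sided limits. -/
def RangeProjPartitionCond {k : ℕ} (r : Fin k → ℕ)
    (P : ∀ j : Fin k, I → MatAlg (r j)) (p0 p1 : ∀ j : Fin k, MatAlg (r j)) : Prop :=
  ∀ j : Fin k, ∃ (m : ℕ) (t : Fin (m + 2) → I) (Pp Pm : Fin (m + 2) → MatAlg (r j)),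
    StrictMono t ∧ t 0 = 0 ∧ t (Fin.last (m + 1)) = 1 ∧
    (∀ l : Fin (m + 1),
      ContinuousOn (P j) (Set.Ioo (t l.castSucc) (t l.succ)) ∧
      ∃ c : ℕ, ∀ s ∈ Set.Ioo (t l.castSucc) (t l.succ), matRank (P j s) = c) ∧
    (∀ l : Fin (m + 2), t l < 1 →
      Filter.Tendsto (P j) (nhdsWithin (t l) (Set.Ioi (t l))) (nhds (Pp l))) ∧
    (∀ l : Fin (m + 2), 0 < t l →
      Filter.Tendsto (P j) (nhdsWithin (t l) (Set.Iio (t l))) (nhds (Pm l))) ∧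
    (∀ l : Fin (m + 2), t l < 1 → (Pp l - P j (t l)).IsPositive) ∧
    (∀ l : Fin (m + 2), 0 < t l → (Pm l - P j (t l)).IsPositive) ∧
    (p0 j = P j 0 ∧ P j 0 = Pp 0) ∧
    (p1 j = P j 1 ∧ P j 1 = Pm (Fin.last (m + 1)))

/-- Projections at distance less than one in a C⋆-algebra are unitarily equivalent. -/
lemma exists_unitary_conj_of_norm_sub_lt_one {A : Type*} [CStarAlgebra A] {p q : A}
    (hp : IsStarProjection p) (hq : IsStarProjection q) (hpq : ‖p - q‖ < 1) :
    ∃ u ∈ unitary A, u * p = q * u := by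
  have hpp : p * p = p := hp.isIdempotentElem
  have hqq : q * q = q := hq.isIdempotentElem
  have hps : star p = p := hp.isSelfAdjoint
  have hqs : star q = q := hq.isSelfAdjoint
  have hpp' (x : A) : p * (p * x) = p * x := by rw [← mul_assoc, hpp]
  have hqq' (x : A) : q * (q * x) = q * x := by rw [← mul_assoc, hqq]
  set m : A := (p - q) * (p - q) with hm
  have hms : IsSelfAdjoint m := by
    simp [IsSelfAdjoint, hm, hps, hqs]
  have hmn : ‖m‖ < 1 := by
    refine (norm_mul_le _ _).trans_lt ?_
    nlinarith [norm_nonneg (p - q)]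
  set z : A := q * p + (1 - q) * (1 - p) with hz
  have hzz : star z * z = 1 - m := by
    simp only [hz, hm, star_add, star_mul, star_sub, star_one, hps, hqs]
    simp only [mul_add, add_mul, mul_sub, sub_mul, mul_one, one_mul, mul_assoc, hpp, hqq, hqq']
    abel
  have hzz' : z * star z = 1 - m := by
    simp only [hz, hm, star_add, star_mul, star_sub, star_one, hps, hqs]
    simp only [mul_add, add_mul, mul_sub, sub_mul, mul_one, one_mul, mul_assoc, hpp, hqq, hpp']
    abel
  have hcz : Commute m z := by
    have h1 : z * (star z * z) = (z * star z) * z := (mul_assoc _ _ _).symm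
    rw [hzz, hzz', mul_sub, sub_mul, mul_one, one_mul] at h1
    exact (sub_right_injective h1).symm
  have hcp : Commute m p := by
    simp only [Commute, SemiconjBy, hm]
    simp only [mul_sub, sub_mul, mul_assoc, hpp, hqq, hpp']
    abel
  set f : ℝ → ℝ := fun x => (√(1 - x))⁻¹
  have hspec : ∀ x ∈ spectrum ℝ m, 0 < 1 - x := by
    intro x hx
    have h1 := spectrum.norm_le_norm_mul_of_mem hx
    have h2 : ‖(1 : A)‖ ≤ 1 := by
      rcases subsingleton_or_nontrivial A with h | h
      · simp [Subsingleton.elim (1 : A) 0]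
      · simp
    have h3 := (le_abs_self x).trans h1
    nlinarith [norm_nonneg m]
  have hf : ContinuousOn f (spectrum ℝ m) := by
    refine ContinuousOn.inv₀ (by fun_prop) fun x hx => (Real.sqrt_pos.2 (hspec x hx)).ne'
  set w : A := cfc f m
  have hws : star w = w := (cfc_predicate f m : IsSelfAdjoint w)
  have hwz : Commute w z := hms.commute_cfc hcz f
  have hwp : Commute w p := hms.commute_cfc hcp f
  have hwmw : w * ((1 - m) * w) = 1 := by
    have h1 : (1 - m) = cfc (fun x : ℝ => 1 - x) m := by
      rw [cfc_sub (fun _ : ℝ => 1) (fun x => x) m continuousOn_const continuousOn_id,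
        cfc_const_one ℝ m hms, cfc_id' ℝ m hms]
    have hg : ContinuousOn (fun x : ℝ => 1 - x) (spectrum ℝ m) := by fun_prop
    rw [h1, ← cfc_mul _ _ m hg hf, ← cfc_mul f (fun x : ℝ => (1 - x) * f x) m hf (hg.mul hf),
      ← cfc_const_one ℝ m hms]
    refine cfc_congr fun x hx => ?_
    have h2 := Real.sqrt_pos.2 (hspec x hx)
    have h3 := Real.mul_self_sqrt (hspec x hx).le
    simp only [f]
    field_simp
    nlinarith
  refine ⟨z * w, ⟨?_, ?_⟩, ?_⟩
  · rw [star_mul, hws, mul_assoc, ← mul_assoc (star z), hzz, hwmw]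
  · have hwz' : star z * w = w * star z := by
      simpa [hws] using congrArg star hwz.eq
    rw [star_mul, hws, ← hwz', ← hwz.eq, mul_assoc, ← mul_assoc z, hzz', hwmw]
  · have h1 : z * p = q * z := by
      simp only [hz]
      simp only [mul_add, add_mul, mul_sub, sub_mul, mul_one, one_mul, mul_assoc, hpp, hqq, hqq']
      abel
    rw [mul_assoc, hwp.eq, ← mul_assoc, h1, mul_assoc]

/-- A continuous path of projections is implemented by a continuous path of unitaries. -/
lemma exists_unitary_path {A : Type*} [CStarAlgebra A] (Q : C(I, A))
    (hQ : ∀ s, IsStarProjection (Q s)) :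
    ∃ U : C(I, A), (∀ s, star (U s) * U s = 1) ∧ (∀ s, U s * star (U s) = 1) ∧
      ∀ s, U s * Q 0 = Q s * U s := by
  let H : I → C(I, A) := fun s => Q.comp ⟨fun t => s * t, by fun_prop⟩
  have hH : ∀ s, IsStarProjection (H s) := fun s =>
    ⟨by ext t; exact (hQ _).isIdempotentElem, by ext t; exact (hQ _).isSelfAdjoint⟩
  have hHc : Continuous H := by
    have : Continuous (fun x : I × I => Q (x.1 * x.2)) := by fun_prop
    exact (ContinuousMap.curry ⟨_, this⟩).continuous
  let R : I → I → Prop := fun x y => ∃ u ∈ unitary C(I, A), u * H x = H y * u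
  have hR : R 0 1 := by
    refine PreconnectedSpace.induction₂' R ?_ ?_ 0 1
    · intro x
      have h1 : ∀ᶠ y in nhds x, ‖H x - H y‖ < 1 := by
        have : Filter.Tendsto (fun y => ‖H x - H y‖) (nhds x) (nhds ‖H x - H x‖) :=
          (continuous_const.sub hHc).norm.continuousAt
        rw [sub_self, norm_zero] at this
        exact this.eventually_lt_const one_pos
      filter_upwards [h1] with y hy
      exact ⟨exists_unitary_conj_of_norm_sub_lt_one (hH x) (hH y) hy,
        exists_unitary_conj_of_norm_sub_lt_one (hH y) (hH x) (by rwa [norm_sub_rev])⟩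
    · refine ⟨?_⟩
      rintro x y w ⟨u, hu, hu'⟩ ⟨v, hv, hv'⟩
      exact ⟨v * u, mul_mem hv hu, by rw [mul_assoc, hu', ← mul_assoc, hv', mul_assoc]⟩
  obtain ⟨U, hU, hU'⟩ := hR
  refine ⟨U, fun s => DFunLike.congr_fun hU.1 s, fun s => DFunLike.congr_fun hU.2 s, fun s => ?_⟩
  have := DFunLike.congr_fun hU' s
  simpa [H] using this

lemma finite_spectrum_of_finiteDimensional (K : Type*) {A : Type*} [Field K] [Ring A] [Algebra K A]
    [FiniteDimensional K A] (x : A) : (spectrum K x).Finite := by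
  have hx : IsIntegral K x := Algebra.IsIntegral.isIntegral x
  refine ((minpoly K x).rootSet_finite K).subset fun y hy => ?_
  rw [Polynomial.mem_rootSet]
  refine ⟨minpoly.ne_zero hx, ?_⟩
  have h1 := spectrum.subset_polynomial_aeval x (minpoly K x) ⟨y, hy, rfl⟩
  rw [minpoly.aeval] at h1
  by_contra h2
  refine h1 ?_
  have h3 : IsUnit (Polynomial.eval y (minpoly K x)) := by
    rw [isUnit_iff_ne_zero]; simpa using h2
  simpa [spectrum.mem_resolventSet_iff] using h3.map (algebraMap K A)

/-- In a finite-dimensional C⋆-algebra, the range projection of a selfadjoint element `x` lies in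
the right ideal generated by `x`. -/
lemma IsRangeProjection.exists_eq_mul {A : Type*} [CStarAlgebra A] [FiniteDimensional ℂ A]
    {x p : A} (hx : IsSelfAdjoint x) (hp : IsRangeProjection x p) : ∃ y, p = x * y := by
  have hfin : (spectrum ℝ x).Finite := by
    have : FiniteDimensional ℝ A := FiniteDimensional.complexToReal A
    exact finite_spectrum_of_finiteDimensional ℝ x
  have hc : ∀ f : ℝ → ℝ, ContinuousOn f (spectrum ℝ x) := fun f => hfin.continuousOn f
  obtain ⟨hps, hpp, hpx, hmin⟩ := hp
  have hid : cfc (fun u : ℝ => u) x = x := cfc_id' ℝ x hx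
  set q : A := cfc (fun u : ℝ => u * u⁻¹) x
  have hq : q = x * cfc (fun u : ℝ => u⁻¹) x := by
    conv_rhs => enter [1]; rw [← hid]
    exact cfc_mul _ _ x (hc _) (hc _)
  have hqs : IsSelfAdjoint q := cfc_predicate _ x
  have hqq : q * q = q := by
    rw [← cfc_mul _ _ x (hc _) (hc _)]
    refine cfc_congr fun u _ => ?_
    by_cases hu : u = 0 <;> simp [hu]
  have hqx : q * x = x := by
    conv_lhs => enter [2]; rw [← hid]
    conv_rhs => rw [← hid]
    rw [← cfc_mul _ _ x (hc _) (hc _)]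
    refine cfc_congr fun u _ => ?_
    by_cases hu : u = 0 <;> simp [hu]
  refine ⟨cfc (fun u : ℝ => u⁻¹) x * p, ?_⟩
  rw [← mul_assoc, ← hq]
  have := congrArg star (hmin q hqs hqq hqx)
  rw [star_mul, hps.star_eq, hqs.star_eq] at this
  exact this.symm

lemma nat_mul_mul_one_sub_pow_le_one {v : ℝ} (h0 : 0 ≤ v) (h1 : v ≤ 1) (n : ℕ) :
    n * (v * (1 - v) ^ n) ≤ 1 := by
  have h2 : 1 + n * v ≤ (1 + v) ^ n := one_add_mul_le_pow (by linarith) n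
  have h3 : 0 ≤ (1 - v) ^ n := pow_nonneg (by linarith) n
  calc n * (v * (1 - v) ^ n) ≤ (1 + n * v) * (1 - v) ^ n := by nlinarith
    _ ≤ (1 + v) ^ n * (1 - v) ^ n := by gcongr
    _ = ((1 + v) * (1 - v)) ^ n := (mul_pow _ _ _).symm
    _ ≤ 1 := pow_le_one₀ (by nlinarith) (by nlinarith)

section Contraction

variable {A : Type*} [CStarAlgebra A]

lemma spectrum_star_mul_self_mem_Icc (s : A) {x : ℝ} (hx : x ∈ spectrum ℝ (star s * s)) :
    0 ≤ x ∧ x ≤ ‖star s * s‖ := by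
  refine ⟨spectrum_star_mul_self_nonneg x hx, ?_⟩
  have h1 := spectrum.norm_le_norm_mul_of_mem hx
  have h2 : ‖(1 : A)‖ ≤ 1 := by
    rcases subsingleton_or_nontrivial A with h | h
    · simp [Subsingleton.elim (1 : A) 0]
    · simp
  have h3 := (le_abs_self x).trans h1
  nlinarith [norm_nonneg (star s * s)]

lemma one_sub_smul_eq_cfc (s : A) (c : ℝ) :
    1 - (c : ℂ) • (star s * s) = cfc (fun x : ℝ => 1 - c * x) (star s * s) := by
  have hs : IsSelfAdjoint (star s * s) := .star_mul_self s
  rw [cfc_sub (fun _ : ℝ => 1) (fun x => c * x) _ (by fun_prop) (by fun_prop),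
    cfc_const_one ℝ _ hs, cfc_const_mul_id c _ hs, Complex.coe_smul]

lemma norm_one_sub_smul_le_one (s : A) {c : ℝ} (hc : 0 ≤ c) (hcs : c * ‖star s * s‖ ≤ 1) :
    ‖1 - (c : ℂ) • (star s * s)‖ ≤ 1 := by
  rw [one_sub_smul_eq_cfc]
  refine norm_cfc_le zero_le_one fun x hx => ?_
  obtain ⟨h0, h1⟩ := spectrum_star_mul_self_mem_Icc s hx
  have := mul_le_mul_of_nonneg_left h1 hc
  rw [Real.norm_eq_abs, abs_le]
  constructor <;> nlinarith

lemma norm_one_sub_smul_pow_mul_le (s : A) {c : ℝ} (hc : 0 < c) (hcs : c * ‖star s * s‖ ≤ 1)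
    {n : ℕ} (hn : 0 < n) :
    ‖(1 - (c : ℂ) • (star s * s)) ^ n * (star s * s)‖ ≤ c⁻¹ / n := by
  have hs : IsSelfAdjoint (star s * s) := .star_mul_self s
  have hn' : (0 : ℝ) < n := by exact_mod_cast hn
  have h1 : (1 - (c : ℂ) • (star s * s)) ^ n * (star s * s)
      = cfc (fun x : ℝ => (1 - c * x) ^ n * x) (star s * s) := by
    rw [cfc_mul _ _ _ (by fun_prop) (by fun_prop), cfc_id' ℝ _ hs,
      cfc_pow _ n _ (by fun_prop) hs, one_sub_smul_eq_cfc]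
  rw [h1]
  refine norm_cfc_le (by positivity) fun x hx => ?_
  obtain ⟨h0, h1⟩ := spectrum_star_mul_self_mem_Icc s hx
  have h2 := mul_le_mul_of_nonneg_left h1 hc.le
  have h3 : 0 ≤ c * x := by positivity
  have h4 := nat_mul_mul_one_sub_pow_le_one h3 (h2.trans hcs) n
  have h5 : 0 ≤ (1 - c * x) ^ n := pow_nonneg (by linarith) n
  rw [Real.norm_of_nonneg (by positivity), le_div_iff₀ hn', ← one_div, le_div_iff₀ hc]
  linarith

lemma tendsto_one_sub_smul_pow_mul (s w : A) {c : ℝ} (hc : 0 < c) (hcs : c * ‖star s * s‖ ≤ 1) :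
    Filter.Tendsto (fun n : ℕ => (1 - (c : ℂ) • (star s * s)) ^ n * (star s * s * w))
      Filter.atTop (nhds 0) := by
  refine squeeze_zero_norm' (a := fun n : ℕ => c⁻¹ * ‖w‖ / n) ?_
    (tendsto_const_div_atTop_nhds_zero_nat _)
  filter_upwards [Filter.eventually_gt_atTop 0] with n hn
  rw [← mul_assoc, mul_div_right_comm]
  exact (norm_mul_le _ _).trans
    (mul_le_mul_of_nonneg_right (norm_one_sub_smul_pow_mul_le s hc hcs hn) (norm_nonneg w))

end Contraction

/-- A Dini argument: if `x` is pointwise in the right ideal generated by the positive element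
`e = s⋆ s`, then `(1 - c e)ⁿ x → 0` uniformly. -/
lemma tendsto_one_sub_smul_pow_mul_of_pointwise {F₁ F₂ : Type} [CStarAlgebra F₁] [CStarAlgebra F₂]
    (s x : C(I, F₂) × F₁) {c : ℝ} (hc : 0 < c) (hcs : c * ‖star s * s‖ ≤ 1)
    (hx₂ : ∀ t, ∃ w, x.1 t = (star s * s).1 t * w) (hx₁ : ∃ w, x.2 = (star s * s).2 * w) :
    Filter.Tendsto (fun n : ℕ => (1 - (c : ℂ) • (star s * s)) ^ n * x) Filter.atTop (nhds 0) := by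
  have hle₂ : ∀ t, c * ‖star (s.1 t) * s.1 t‖ ≤ 1 := fun t => by
    refine le_trans (mul_le_mul_of_nonneg_left ?_ hc.le) hcs
    exact ((star s * s).1.norm_coe_le_norm t).trans (norm_fst_le _)
  have hle₁ : c * ‖star s.2 * s.2‖ ≤ 1 :=
    le_trans (mul_le_mul_of_nonneg_left (norm_snd_le (star s * s)) hc.le) hcs
  rw [Prod.tendsto_iff]
  constructor
  · rw [ContinuousMap.tendsto_iff_tendstoUniformly, Metric.tendstoUniformly_iff]
    have key : TendstoUniformly
        (fun (n : ℕ) t => ‖((1 - (c : ℂ) • (star s * s)) ^ n * x).1 t‖) (fun _ => (0 : ℝ))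
        Filter.atTop := by
      refine Antitone.tendstoUniformly_of_forall_tendsto (fun n => by fun_prop) ?_
        continuous_const ?_
      · refine antitone_nat_of_succ_le fun n t => ?_
        have h1 := norm_one_sub_smul_le_one (s.1 t) hc.le (hle₂ t)
        have h2 : ((1 - (c : ℂ) • (star s * s)) ^ (n + 1) * x).1 t
            = (1 - (c : ℂ) • (star (s.1 t) * s.1 t))
              * ((1 - (c : ℂ) • (star s * s)) ^ n * x).1 t := by
          rw [pow_succ', mul_assoc]; rfl
        simp only [h2]
        refine (norm_mul_le _ _).trans ?_
        exact mul_le_of_le_one_left (norm_nonneg _) h1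
      · intro t
        obtain ⟨w, hw⟩ := hx₂ t
        have h1 := (tendsto_one_sub_smul_pow_mul (s.1 t) w hc (hle₂ t)).norm
        rw [norm_zero] at h1
        refine h1.congr fun n => ?_
        have h2 : ((1 - (c : ℂ) • (star s * s)) ^ n * x).1 t
            = (1 - (c : ℂ) • (star (s.1 t) * s.1 t)) ^ n * x.1 t := by
          simp
        rw [h2, hw]; rfl
    rw [Metric.tendstoUniformly_iff] at key
    intro ε hε
    filter_upwards [key ε hε] with n hn t
    simpa using hn t
  · obtain ⟨w, hw⟩ := hx₁
    refine (tendsto_one_sub_smul_pow_mul s.2 w hc hle₁).congr fun n => ?_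
    simp [hw]

/-- A selfadjoint left unit `p` of `x` in the right ideal generated by `x`: the algebraic
content of being the range projection of `x`. -/
def IsRangeUnit {A : Type*} [NonUnitalSemiring A] [Star A] (x p : A) : Prop :=
  star p = p ∧ p * x = x ∧ ∃ y, p = x * y

lemma isClosed_ETBlockSubalg {F₁ F₂ : Type} [CStarAlgebra F₁] [CStarAlgebra F₂]
    (φ₀ φ₁ : F₁ →⋆ₙₐ[ℂ] F₂) :
    IsClosed (ETBlockSubalg F₁ F₂ φ₀ φ₁ : Set (C(I, F₂) × F₁)) := by
  have h₀ : Continuous φ₀ :=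
    AddMonoidHomClass.continuous_of_bound φ₀ 1 fun x => by
      simpa using NonUnitalStarAlgHom.norm_apply_le φ₀ x
  have h₁ : Continuous φ₁ :=
    AddMonoidHomClass.continuous_of_bound φ₁ 1 fun x => by
      simpa using NonUnitalStarAlgHom.norm_apply_le φ₁ x
  exact (isClosed_eq (by fun_prop) (by fun_prop)).inter
    (isClosed_eq (f := fun p : C(I, F₂) × F₁ => p.1 1) (by fun_prop) (by fun_prop))

section Hereditary

variable {E : Type*}

lemma heredSubalg_subset [NonUnitalCStarAlgebra E] {B : NonUnitalStarSubalgebra ℂ E}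
    {e : E} (heB : e ∈ B) (hse : star e = e) {K : Set E} (hK : IsClosed K)
    (h : ∀ b ∈ B, e * b * e ∈ K) : ↑(heredSubalg B e heB hse) ⊆ K :=
  closure_minimal (by rintro _ ⟨b, hb, rfl⟩; exact h b hb) hK

variable [CStarAlgebra E]

lemma mem_heredSubalg_of_tendsto {B : NonUnitalStarSubalgebra ℂ E} {e : E} (heB : e ∈ B)
    (hse : star e = e) {x : E} (hx : x ∈ B) {c : ℝ} (hc : ‖1 - (c : ℂ) • e‖ ≤ 1)
    (h₁ : Filter.Tendsto (fun n : ℕ => (1 - (c : ℂ) • e) ^ n * x) Filter.atTop (nhds 0))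
    (h₂ : Filter.Tendsto (fun n : ℕ => (1 - (c : ℂ) • e) ^ n * star x) Filter.atTop (nhds 0)) :
    x ∈ heredSubalg B e heB hse := by
  set T : E := 1 - (c : ℂ) • e with hT
  have hTs : star T = T := by simp [hT, hse]
  have hTB : ∀ (i : ℕ), ∀ b ∈ B, T ^ i * b ∈ B := by
    intro i
    induction i with
    | zero => intro b hb; simpa using hb
    | succ i ih =>
      intro b hb
      rw [pow_succ, mul_assoc]
      refine ih _ ?_
      rw [hT, sub_mul, one_mul, smul_mul_assoc]
      exact sub_mem hb (SMulMemClass.smul_mem _ (mul_mem heB hb))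
  have hGB : ∀ (n : ℕ), ∀ b ∈ B, (∑ i ∈ Finset.range n, T ^ i) * b ∈ B := by
    intro n b hb
    rw [Finset.sum_mul]
    exact sum_mem fun i _ => hTB i b hb
  have hGs : ∀ n : ℕ, star (∑ i ∈ Finset.range n, T ^ i) = ∑ i ∈ Finset.range n, T ^ i := by
    intro n
    simp [star_sum, hTs]
  have hBG : ∀ (n : ℕ), ∀ b ∈ B, b * (∑ i ∈ Finset.range n, T ^ i) ∈ B := by
    intro n b hb
    have := star_mem (hGB n (star b) (star_mem hb))
    rwa [star_mul, star_star, hGs] at this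
  have h1T : (c : ℂ) • e = 1 - T := by simp [hT]
  have h₃ : Filter.Tendsto (fun n : ℕ => x * T ^ n) Filter.atTop (nhds 0) := by
    have := (continuous_star.tendsto (0 : E)).comp h₂
    rw [star_zero] at this
    refine this.congr fun n => ?_
    simp [hTs]
  have h₄ : Filter.Tendsto (fun n : ℕ => T ^ n * x * T ^ n) Filter.atTop (nhds 0) := by
    refine squeeze_zero_norm (fun n => ?_) (by simpa using h₁.norm)
    refine (norm_mul_le _ _).trans (mul_le_of_le_one_right (norm_nonneg _) ?_)
    rcases n with _ | n
    · rcases subsingleton_or_nontrivial E with h | h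
      · simp [Subsingleton.elim (1 : E) 0]
      · simp
    · exact (norm_pow_le' _ n.succ_pos).trans (pow_le_one₀ (norm_nonneg _) hc)
  have h₅ : Filter.Tendsto (fun n : ℕ => (1 - T ^ n) * x * (1 - T ^ n)) Filter.atTop (nhds x) := by
    have := ((tendsto_const_nhds (x := x)).sub h₁).sub (h₃.sub h₄)
    simp only [sub_zero] at this
    refine this.congr fun n => ?_
    noncomm_ring
  refine mem_closure_of_tendsto h₅ (Filter.Eventually.of_forall fun n => ?_)
  refine ⟨((c : ℂ) * c) • ((∑ i ∈ Finset.range n, T ^ i) * x * (∑ i ∈ Finset.range n, T ^ i)),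
    SMulMemClass.smul_mem _ (hBG n _ (hGB n x hx)), ?_⟩
  have e₁ : 1 - T ^ n = ((c : ℂ) • e) * ∑ i ∈ Finset.range n, T ^ i := by
    rw [h1T, mul_neg_geom_sum]
  have e₂ : 1 - T ^ n = (∑ i ∈ Finset.range n, T ^ i) * ((c : ℂ) • e) := by
    rw [h1T, geom_sum_mul_neg]
  conv_lhs => enter [2]; rw [e₂]
  rw [e₁]
  simp only [smul_mul_assoc, mul_smul_comm, smul_smul, mul_assoc]

end Hereditary

/-- The hereditary subalgebra generated by a positive element of a building block consists of the
elements which are pointwise supported by the range projections of that element. -/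
lemma mem_heredSubalg_ETBlockSubalg_iff {F₁ F₂ : Type} [CStarAlgebra F₁] [CStarAlgebra F₂]
    {φ₀ φ₁ : F₁ →⋆ₙₐ[ℂ] F₂} {e : C(I, F₂) × F₁} (heB : e ∈ ETBlockSubalg F₁ F₂ φ₀ φ₁)
    (hse : star e = e) (hpos : ∃ s, e = star s * s) {P : I → F₂} {p : F₁}
    (hP : ∀ t, IsRangeUnit (e.1 t) (P t)) (hp : IsRangeUnit e.2 p) (x : C(I, F₂) × F₁) :
    x ∈ heredSubalg (ETBlockSubalg F₁ F₂ φ₀ φ₁) e heB hse ↔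
      x ∈ ETBlockSubalg F₁ F₂ φ₀ φ₁ ∧ (∀ t, P t * x.1 t = x.1 t ∧ x.1 t * P t = x.1 t) ∧
        p * x.2 = x.2 ∧ x.2 * p = x.2 := by
  have hse₂ : ∀ t, star (e.1 t) = e.1 t := fun t =>
    DFunLike.congr_fun (congrArg Prod.fst hse) t
  have hse₁ : star e.2 = e.2 := congrArg Prod.snd hse
  have heP : ∀ t, e.1 t * P t = e.1 t := fun t => by
    have := congrArg star (hP t).2.1
    rwa [star_mul, (hP t).1, hse₂] at this
  have hep : e.2 * p = e.2 := by
    have := congrArg star hp.2.1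
    rwa [star_mul, hp.1, hse₁] at this
  constructor
  · intro hx
    refine ⟨heredSubalg_subset heB hse (isClosed_ETBlockSubalg φ₀ φ₁)
      (fun b hb => mul_mem (mul_mem heB hb) heB) hx, fun t => ⟨?_, ?_⟩, ?_, ?_⟩
    · refine heredSubalg_subset heB hse (K := {x | P t * x.1 t = x.1 t})
        (isClosed_eq (by fun_prop) (by fun_prop)) (fun b _ => ?_) hx
      change P t * (e.1 t * b.1 t * e.1 t) = e.1 t * b.1 t * e.1 t
      rw [← mul_assoc, ← mul_assoc, (hP t).2.1]
    · refine heredSubalg_subset heB hse (K := {x | x.1 t * P t = x.1 t})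
        (isClosed_eq (by fun_prop) (by fun_prop)) (fun b _ => ?_) hx
      change e.1 t * b.1 t * e.1 t * P t = e.1 t * b.1 t * e.1 t
      rw [mul_assoc, heP]
    · refine heredSubalg_subset heB hse (K := {x | p * x.2 = x.2})
        (isClosed_eq (by fun_prop) (by fun_prop)) (fun b _ => ?_) hx
      change p * (e.2 * b.2 * e.2) = e.2 * b.2 * e.2
      rw [← mul_assoc, ← mul_assoc, hp.2.1]
    · refine heredSubalg_subset heB hse (K := {x | x.2 * p = x.2})
        (isClosed_eq (by fun_prop) (by fun_prop)) (fun b _ => ?_) hx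
      change e.2 * b.2 * e.2 * p = e.2 * b.2 * e.2
      rw [mul_assoc, hep]
  · rintro ⟨hxB, hx₂, hx₁, hx₁'⟩
    obtain ⟨s, rfl⟩ := hpos
    set c : ℝ := (‖star s * s‖ + 1)⁻¹
    have hc : 0 < c := by positivity
    have hcs : c * ‖star s * s‖ ≤ 1 := by
      rw [inv_mul_le_iff₀ (by positivity)]; linarith
    refine mem_heredSubalg_of_tendsto heB hse hxB (c := c)
      (norm_one_sub_smul_le_one s hc.le hcs)
      (tendsto_one_sub_smul_pow_mul_of_pointwise s x hc hcs (fun t => ?_) ?_)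
      (tendsto_one_sub_smul_pow_mul_of_pointwise s (star x) hc hcs (fun t => ?_) ?_)
    · obtain ⟨y, hy⟩ := (hP t).2.2
      exact ⟨y * x.1 t, by rw [← mul_assoc, ← hy, (hx₂ t).1]⟩
    · obtain ⟨y, hy⟩ := hp.2.2
      exact ⟨y * x.2, by rw [← mul_assoc, ← hy, hx₁]⟩
    · obtain ⟨y, hy⟩ := (hP t).2.2
      refine ⟨y * star (x.1 t), ?_⟩
      have := congrArg star (hx₂ t).2
      rw [star_mul, (hP t).1] at this
      rw [← mul_assoc, ← hy, this]; rfl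
    · obtain ⟨y, hy⟩ := hp.2.2
      refine ⟨y * star x.2, ?_⟩
      have := congrArg star hx₁'
      rw [star_mul, hp.1] at this
      rw [← mul_assoc, ← hy, this]; rfl

section Lift

variable {X Y Z : Type*} [NonUnitalRing X] [StarRing X] [Module ℂ X]
  [NonUnitalRing Y] [StarRing Y] [Module ℂ Y] [NonUnitalRing Z] [StarRing Z] [Module ℂ Z]

lemma exists_starAlgHom_lift (α : X →⋆ₙₐ[ℂ] Z) (β : Y →⋆ₙₐ[ℂ] Z)
    (hβ : Function.Injective β) (h : ∀ x, ∃ y, β y = α x) :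
    ∃ ψ : X →⋆ₙₐ[ℂ] Y, ∀ x, β (ψ x) = α x := by
  choose f hf using h
  exact ⟨
    { toFun := f
      map_smul' := fun c x => hβ (by simp [hf])
      map_zero' := hβ (by simp [hf])
      map_add' := fun x y => hβ (by simp [hf])
      map_mul' := fun x y => hβ (by simp [hf])
      map_star' := fun x => hβ (by simp [hf, map_star]) }, hf⟩

lemma nonempty_starAlgEquiv (α : X →⋆ₙₐ[ℂ] Z) (β : Y →⋆ₙₐ[ℂ] Z)
    (hα : Function.Injective α) (hβ : Function.Injective β) (h : ∀ x, ∃ y, β y = α x)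
    (h' : ∀ y, ∃ x, α x = β y) : Nonempty (X ≃⋆ₐ[ℂ] Y) := by
  obtain ⟨ψ, hψ⟩ := exists_starAlgHom_lift α β hβ h
  refine ⟨StarAlgEquiv.ofBijective ψ ⟨fun x x' hx => hα ?_, fun y => ?_⟩⟩
  · rw [← hψ, ← hψ, hx]
  · obtain ⟨x, hx⟩ := h' y
    exact ⟨x, hβ (by rw [hψ, hx])⟩

end Lift

/-- A star subalgebra of a finite-dimensional C⋆-algebra which has a unit (not necessarily that of
the ambient algebra) is a unital C⋆-algebra. -/
lemma exists_cstarAlgebra_of_unit {B : Type} [CStarAlgebra B] [FiniteDimensional ℂ B]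
    (S : NonUnitalStarSubalgebra ℂ B) (e : B) (he : e ∈ S)
    (hl : ∀ x ∈ S, e * x = x) (hr : ∀ x ∈ S, x * e = x) :
    ∃ (E : Type) (_ : CStarAlgebra E) (_ : FiniteDimensional ℂ E) (ι : E →⋆ₙₐ[ℂ] B),
      Isometry ι ∧ ∀ x, x ∈ S ↔ ∃ y, ι y = x := by
  have hfd : FiniteDimensional ℂ S :=
    inferInstanceAs (FiniteDimensional ℂ S.toNonUnitalSubalgebra.toSubmodule)
  have hcl : IsClosed (S : Set B) := S.toNonUnitalSubalgebra.toSubmodule.closed_of_finiteDimensional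
  let i₀ : NonUnitalCStarAlgebra S := inferInstance
  let one : One S := ⟨⟨e, he⟩⟩
  let ring : NormedRing S :=
    { i₀.toNonUnitalNormedRing with
      one := ⟨e, he⟩
      one_mul := fun x => Subtype.ext (hl x x.2)
      mul_one := fun x => Subtype.ext (hr x x.2) }
  let alg : NormedAlgebra ℂ S :=
    { Algebra.ofModule (R := ℂ) (A := S) (fun c x y => smul_mul_assoc c x y)
        (fun c x y => mul_smul_comm c x y) with
      norm_smul_le := fun c x => norm_smul_le c x }
  let i : CStarAlgebra S :=
    { ring, i₀, alg with }
  exact ⟨S, i, hfd, NonUnitalStarSubalgebraClass.subtype S, isometry_subtype_coe,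
    fun x => ⟨fun hx => ⟨⟨x, hx⟩, rfl⟩, by rintro ⟨y, rfl⟩; exact y.2⟩⟩

/-- The affine parametrization of the segment from `a` to `b`. -/
def segmentMap (a b : I) : C(I, I) where
  toFun s := ⟨(1 - s) * a + s * b, by
    have h1 := mul_nonneg (sub_nonneg.2 s.2.2) a.2.1
    have h2 := mul_nonneg s.2.1 b.2.1
    have h3 := mul_nonneg (sub_nonneg.2 s.2.2) (sub_nonneg.2 a.2.2)
    have h4 := mul_nonneg s.2.1 (sub_nonneg.2 b.2.2)
    constructor <;> nlinarith⟩
  continuous_toFun := by fun_prop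

lemma segmentMap_zero (a b : I) : segmentMap a b 0 = a := by
  ext; simp [segmentMap]

lemma segmentMap_one (a b : I) : segmentMap a b 1 = b := by
  ext; simp [segmentMap]

lemma strictMono_segmentMap {a b : I} (hab : a < b) : StrictMono (segmentMap a b) := by
  intro s s' hs
  rw [← Subtype.coe_lt_coe] at hs hab ⊢
  simp only [segmentMap, ContinuousMap.coe_mk]
  nlinarith

lemma exists_segmentMap_eq {a b u : I} (hau : a ≤ u) (hub : u ≤ b) :
    ∃ s, segmentMap a b s = u := by
  have := intermediate_value_univ 0 1 (segmentMap a b).continuous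
  rw [segmentMap_zero, segmentMap_one] at this
  exact this ⟨hau, hub⟩

section Partition

variable {m : ℕ} {t : Fin (m + 2) → I}

lemma exists_segmentMap_partition_eq (h0 : t 0 = 0) (h1 : t (Fin.last (m + 1)) = 1) (u : I) :
    ∃ (l : Fin (m + 1)) (s : I), segmentMap (t l.castSucc) (t l.succ) s = u := by
  have key : ∀ n : Fin (m + 2), u ≤ t n → ∃ l : Fin (m + 1), t l.castSucc ≤ u ∧ u ≤ t l.succ := by
    intro n
    induction n using Fin.induction with
    | zero =>
      intro hu
      rw [h0] at hu
      have hu0 : u = 0 := le_antisymm hu bot_le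
      exact ⟨0, by simp [h0], by rw [hu0]; exact bot_le⟩
    | succ l ih =>
      intro hu
      rcases le_total u (t l.castSucc) with h | h
      · exact ih h
      · exact ⟨l, h, hu⟩
  obtain ⟨l, hl, hl'⟩ := key (Fin.last _) (by rw [h1]; exact le_top)
  obtain ⟨s, hs⟩ := exists_segmentMap_eq hl hl'
  exact ⟨l, s, hs⟩

lemma segmentMap_partition_eq_of_lt (ht : StrictMono t) {l l' : Fin (m + 1)} (hll : l < l')
    {s s' : I} (h : segmentMap (t l.castSucc) (t l.succ) s
      = segmentMap (t l'.castSucc) (t l'.succ) s') :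
    s = 1 ∧ s' = 0 ∧ l.succ = l'.castSucc := by
  have hm := strictMono_segmentMap (ht l.castSucc_lt_succ)
  have hm' := strictMono_segmentMap (ht l'.castSucc_lt_succ)
  have a1 : segmentMap (t l.castSucc) (t l.succ) s ≤ t l.succ := by
    conv_rhs => rw [← segmentMap_one (t l.castSucc) (t l.succ)]
    exact hm.monotone le_top
  have a2 : t l'.castSucc ≤ segmentMap (t l'.castSucc) (t l'.succ) s' := by
    conv_lhs => rw [← segmentMap_zero (t l'.castSucc) (t l'.succ)]
    exact hm'.monotone bot_le
  have a3 : l.succ ≤ l'.castSucc := by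
    rw [Fin.le_def]; simpa using hll
  have a4 := ht.monotone a3
  refine ⟨hm.injective ?_, hm'.injective ?_, ht.injective ?_⟩
  · rw [segmentMap_one]; order
  · rw [segmentMap_zero]; order
  · order

/-- Gluing of continuous functions on the pieces of a partition. -/
lemma exists_glue {X : Type*} [TopologicalSpace X] (ht : StrictMono t) (h0 : t 0 = 0)
    (h1 : t (Fin.last (m + 1)) = 1) (F : Fin (m + 1) → C(I, X)) (x : Fin (m + 2) → X)
    (hF0 : ∀ l, F l 0 = x l.castSucc) (hF1 : ∀ l, F l 1 = x l.succ) :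
    ∃ f : C(I, X), ∀ l s, f (segmentMap (t l.castSucc) (t l.succ) s) = F l s := by
  let π : C(Σ _ : Fin (m + 1), I, I) :=
    ⟨fun y => segmentMap (t y.1.castSucc) (t y.1.succ) y.2, by
      rw [continuous_sigma_iff]; intro l; exact (segmentMap (t l.castSucc) (t l.succ)).continuous⟩
  let G : C(Σ _ : Fin (m + 1), I, X) :=
    ⟨fun y => F y.1 y.2, by rw [continuous_sigma_iff]; intro l; exact (F l).continuous⟩
  have hπ : Topology.IsQuotientMap π := by
    refine π.continuous.isClosedMap.isQuotientMap π.continuous fun u => ?_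
    obtain ⟨l, s, hs⟩ := exists_segmentMap_partition_eq h0 h1 u
    exact ⟨⟨l, s⟩, hs⟩
  have hlt : ∀ (l l' : Fin (m + 1)) (s s' : I), l < l' → π ⟨l, s⟩ = π ⟨l', s'⟩ →
      F l s = F l' s' := by
    intro l l' s s' hll h
    obtain ⟨rfl, rfl, h'⟩ := segmentMap_partition_eq_of_lt ht hll h
    rw [hF1, hF0, h']
  have hG : ∀ y y', π y = π y' → G y = G y' := by
    rintro ⟨l, s⟩ ⟨l', s'⟩ h
    rcases lt_trichotomy l l' with hll | rfl | hll
    · exact hlt _ _ _ _ hll h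
    · exact congrArg (F l) ((strictMono_segmentMap (ht l.castSucc_lt_succ)).injective h)
    · exact (hlt _ _ _ _ hll h.symm).symm
  refine ⟨hπ.lift G hG, fun l s => ?_⟩
  exact DFunLike.congr_fun (hπ.lift_comp G hG) ⟨l, s⟩

end Partition

/-- Post-composition of paths with a star homomorphism. -/
def postcompHom {E A : Type} [CStarAlgebra E] [CStarAlgebra A] (φ : E →⋆ₙₐ[ℂ] A)
    (hφ : Continuous φ) : C(I, E) →⋆ₙₐ[ℂ] C(I, A) where
  toFun f := ⟨fun s => φ (f s), hφ.comp f.continuous⟩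
  map_smul' c f := by ext s; simp
  map_zero' := by ext s; simp
  map_add' f g := by ext s; simp
  map_mul' f g := by ext s; simp
  map_star' f := by ext s; simp [map_star]

/-- Conjugation by a coisometry. -/
def conjHom {A : Type} [CStarAlgebra A] (u : A) (hu : u * star u = 1) : A →⋆ₙₐ[ℂ] A where
  toFun x := star u * x * u
  map_smul' c x := by simp
  map_zero' := by simp
  map_add' x y := by simp [mul_add, add_mul]
  map_mul' x y := by
    have : u * (star u * (y * u)) = y * u := by rw [← mul_assoc, hu, one_mul]
    simp only [mul_assoc, this]
  map_star' x := by simp [mul_assoc]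

section Core

variable {k : ℕ} {M : Fin k → Type} [∀ j, CStarAlgebra (M j)] {m : Fin k → ℕ}

/-- Restriction of a tuple of paths to the pieces of partitions, conjugated by a unitary path. -/
def piecesHom (t : ∀ j, Fin (m j + 2) → I) (U : C(I, ∀ i : (Σ j, Fin (m j + 1)), M i.1))
    (hU : ∀ s, U s * star (U s) = 1) :
    C(I, ∀ j, M j) →⋆ₙₐ[ℂ] C(I, ∀ i : (Σ j, Fin (m j + 1)), M i.1) where
  toFun f := ⟨fun s => conjHom (U s) (hU s)
    (fun i => f (segmentMap (t i.1 i.2.castSucc) (t i.1 i.2.succ) s) i.1), by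
      have : Continuous fun s => fun i : (Σ j, Fin (m j + 1)) =>
        f (segmentMap (t i.1 i.2.castSucc) (t i.1 i.2.succ) s) i.1 := by fun_prop
      exact (U.continuous.star.mul this).mul U.continuous⟩
  map_smul' c f := by
    ext1 s; exact map_smul (conjHom (U s) (hU s)) c _
  map_zero' := by ext1 s; exact map_zero (conjHom (U s) (hU s))
  map_add' f g := by ext1 s; exact map_add (conjHom (U s) (hU s)) _ _
  map_mul' f g := by ext1 s; exact map_mul (conjHom (U s) (hU s)) _ _
  map_star' f := by ext1 s; exact map_star (conjHom (U s) (hU s)) _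

/-- Evaluation of a tuple of paths at partition points. -/
def evalPointsHom (t : ∀ j, Fin (m j + 2) → I) :
    C(I, ∀ j, M j) →⋆ₙₐ[ℂ] (∀ y : (Σ j, Fin (m j + 2)), M y.1) where
  toFun f y := f (t y.1 y.2) y.1
  map_smul' _ _ := rfl
  map_zero' := rfl
  map_add' _ _ := rfl
  map_mul' _ _ := rfl
  map_star' _ := rfl

/-- Restriction of a tuple indexed by partition points along a choice of points. -/
def pointsToPiecesHom (c : ∀ j, Fin (m j + 1) → Fin (m j + 2)) :
    (∀ y : (Σ j, Fin (m j + 2)), M y.1) →⋆ₙₐ[ℂ] (∀ i : (Σ j, Fin (m j + 1)), M i.1) where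
  toFun x i := x ⟨i.1, c i.1 i.2⟩
  map_smul' _ _ := rfl
  map_zero' := rfl
  map_add' _ _ := rfl
  map_mul' _ _ := rfl
  map_star' _ := rfl

/-- The corner of a projection. -/
def cornerSubalg {A : Type} [CStarAlgebra A] (q : A) (hq : star q = q) :
    NonUnitalStarSubalgebra ℂ A where
  carrier := {x | q * x = x ∧ x * q = x}
  add_mem' := by rintro x y ⟨h1, h2⟩ ⟨h3, h4⟩; simp [mul_add, add_mul, *]
  mul_mem' := by
    rintro x y ⟨h1, h2⟩ ⟨h3, h4⟩
    exact ⟨by rw [← mul_assoc, h1], by rw [mul_assoc, h4]⟩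
  smul_mem' := by rintro c x ⟨h1, h2⟩; simp [*]
  zero_mem' := by simp
  star_mem' := by
    rintro x ⟨h1, h2⟩
    exact ⟨by simpa [hq] using congrArg star h2, by simpa [hq] using congrArg star h1⟩

variable {F₁ : Type} [CStarAlgebra F₁]

/-- The tuples of elements of corners at the partition points which are compatible with the
boundary maps at the end points. -/
def boundarySubalg (φ₀ φ₁ : F₁ →⋆ₙₐ[ℂ] (∀ j, M j))
    (p : F₁ × (∀ y : (Σ j, Fin (m j + 2)), M y.1)) (hp : star p = p) :
    NonUnitalStarSubalgebra ℂ (F₁ × (∀ y : (Σ j, Fin (m j + 2)), M y.1)) :=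
  cornerSubalg p hp ⊓
  { carrier := {x | ∀ j, x.2 ⟨j, 0⟩ = φ₀ x.1 j ∧ x.2 ⟨j, Fin.last _⟩ = φ₁ x.1 j}
    add_mem' := by intro x y hx hy j; simp [hx j, hy j]
    mul_mem' := by intro x y hx hy j; simp [hx j, hy j]
    smul_mem' := by intro c x hx j; simp [hx j]
    zero_mem' := by intro j; simp
    star_mem' := by intro x hx j; simp [hx j, map_star] }

/-- The elements of a building block which are pointwise supported by a piecewise continuous field
`P` of projections form a building block, provided that on each piece `P` is dominated by a
continuous path of projections which agrees with `P` in the interior of the piece. -/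
lemma nonempty_starAlgEquiv_ETBlockSubalg [FiniteDimensional ℂ F₁]
    [∀ j, FiniteDimensional ℂ (M j)]
    (φ₀ φ₁ : F₁ →⋆ₙₐ[ℂ] (∀ j, M j)) (P : ∀ j, I → M j) (p : F₁)
    (hp : IsStarProjection p) (hP : ∀ j s, IsStarProjection (P j s))
    (hp0 : ∀ j, φ₀ p j = P j 0) (hp1 : ∀ j, φ₁ p j = P j 1)
    (D : NonUnitalStarSubalgebra ℂ (C(I, ∀ j, M j) × F₁))
    (hD : ∀ x, x ∈ D ↔ x ∈ ETBlockSubalg F₁ (∀ j, M j) φ₀ φ₁ ∧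
      (∀ j s, P j s * x.1 s j = x.1 s j ∧ x.1 s j * P j s = x.1 s j) ∧
        p * x.2 = x.2 ∧ x.2 * p = x.2)
    (t : ∀ j, Fin (m j + 2) → I) (ht : ∀ j, StrictMono (t j)) (ht0 : ∀ j, t j 0 = 0)
    (ht1 : ∀ j, t j (Fin.last _) = 1)
    (Q : C(I, ∀ i : (Σ j, Fin (m j + 1)), M i.1)) (hQ : ∀ s, IsStarProjection (Q s))
    (hQP : ∀ s i, Q s i * P i.1 (segmentMap (t i.1 i.2.castSucc) (t i.1 i.2.succ) s)
      = P i.1 (segmentMap (t i.1 i.2.castSucc) (t i.1 i.2.succ) s))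
    (hQP' : ∀ s ∈ Set.Ioo (0 : I) 1, ∀ i,
      Q s i = P i.1 (segmentMap (t i.1 i.2.castSucc) (t i.1 i.2.succ) s)) :
    ∃ (E₁ E₂ : Type) (i₁ : CStarAlgebra E₁) (i₂ : CStarAlgebra E₂),
      letI := i₁; letI := i₂;
      ∃ (_ : FiniteDimensional ℂ E₁) (_ : FiniteDimensional ℂ E₂)
        (ψ₀ ψ₁ : E₁ →⋆ₙₐ[ℂ] E₂), Nonempty (D ≃⋆ₐ[ℂ] (ETBlockSubalg E₁ E₂ ψ₀ ψ₁)) := by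
  obtain ⟨U, hU, hU', hUQ⟩ := exists_unitary_path Q hQ
  -- absorption rules for the projections and the unitaries
  have hQs : ∀ s, star (Q s) = Q s := fun s => (hQ s).isSelfAdjoint
  have hPs : ∀ j s, star (P j s) = P j s := fun j s => (hP j s).isSelfAdjoint
  have hUQ' : ∀ s, Q 0 * star (U s) = star (U s) * Q s := fun s => by
    simpa [hQs] using congrArg star (hUQ s)
  have hPQ : ∀ s i, P i.1 (segmentMap (t i.1 i.2.castSucc) (t i.1 i.2.succ) s) * Q s i
      = P i.1 (segmentMap (t i.1 i.2.castSucc) (t i.1 i.2.succ) s) := fun s i => by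
    have h1 := congrArg star (hQP s i)
    have h2 : star (Q s i) = Q s i := congrFun (hQs s) i
    rwa [star_mul, hPs, h2] at h1
  -- the two finite-dimensional algebras
  set pp : F₁ × (∀ y : (Σ j, Fin (m j + 2)), M y.1) := (p, fun y => P y.1 (t y.1 y.2)) with hpp
  have hpps : star pp = pp :=
    Prod.ext hp.isSelfAdjoint (funext fun y => hPs _ _)
  have hppp : pp * pp = pp :=
    Prod.ext hp.isIdempotentElem (funext fun y => (hP _ _).isIdempotentElem)
  obtain ⟨E₁, i₁, fd₁, ι₁, hι₁, hS₁⟩ := exists_cstarAlgebra_of_unit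
    (boundarySubalg φ₀ φ₁ pp hpps) pp
    ⟨⟨hppp, hppp⟩, fun j => by simp [hpp, ht0, ht1, hp0, hp1]⟩ (fun x hx => hx.1.1)
    (fun x hx => hx.1.2)
  obtain ⟨E₂, i₂, fd₂, ι₂, hι₂, hS₂⟩ := exists_cstarAlgebra_of_unit
    (cornerSubalg (Q 0) (hQs 0)) (Q 0) ⟨(hQ 0).isIdempotentElem, (hQ 0).isIdempotentElem⟩
    (fun x hx => hx.1) (fun x hx => hx.2)
  have hS₁' : ∀ x, ι₁ x ∈ boundarySubalg φ₀ φ₁ pp hpps := fun x => (hS₁ _).2 ⟨x, rfl⟩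
  have hS₂' : ∀ x, ι₂ x ∈ cornerSubalg (Q 0) (hQs 0) := fun x => (hS₂ _).2 ⟨x, rfl⟩
  have hconj : ∀ s (x : ∀ i : (Σ j, Fin (m j + 1)), M i.1),
      (∀ i, P i.1 (segmentMap (t i.1 i.2.castSucc) (t i.1 i.2.succ) s) * x i = x i) →
      (∀ i, x i * P i.1 (segmentMap (t i.1 i.2.castSucc) (t i.1 i.2.succ) s) = x i) →
      ∃ y, ι₂ y = conjHom (U s) (hU' s) x := by
    intro s x h1 h2
    refine (hS₂ _).1 ⟨?_, ?_⟩
    · change Q 0 * (star (U s) * x * U s) = star (U s) * x * U s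
      have : Q s * x = x := funext fun i => by
        change Q s i * x i = x i
        rw [← h1 i, ← mul_assoc, hQP]
      rw [← mul_assoc, ← mul_assoc, hUQ', mul_assoc _ (Q s), this]
    · change star (U s) * x * U s * Q 0 = star (U s) * x * U s
      have : x * Q s = x := funext fun i => by
        change x i * Q s i = x i
        rw [← h2 i, mul_assoc, hPQ]
      rw [mul_assoc, hUQ, ← mul_assoc, mul_assoc _ x, this]
  -- the boundary maps
  obtain ⟨ψ₀, hψ₀⟩ := exists_starAlgHom_lift
    ((conjHom (U 0) (hU' 0)).comp ((pointsToPiecesHom fun _ l => l.castSucc).comp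
      ((NonUnitalStarAlgHom.snd ℂ _ _).comp ι₁))) ι₂ hι₂.injective (fun x => by
      have h := (hS₁' x).1
      refine hconj 0 _ (fun i => ?_) (fun i => ?_)
      · rw [segmentMap_zero]
        exact congrFun (congrArg Prod.snd h.1) ⟨i.1, i.2.castSucc⟩
      · rw [segmentMap_zero]
        exact congrFun (congrArg Prod.snd h.2) ⟨i.1, i.2.castSucc⟩)
  obtain ⟨ψ₁, hψ₁⟩ := exists_starAlgHom_lift
    ((conjHom (U 1) (hU' 1)).comp ((pointsToPiecesHom fun _ l => l.succ).comp
      ((NonUnitalStarAlgHom.snd ℂ _ _).comp ι₁))) ι₂ hι₂.injective (fun x => by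
      have h := (hS₁' x).1
      refine hconj 1 _ (fun i => ?_) (fun i => ?_)
      · rw [segmentMap_one]
        exact congrFun (congrArg Prod.snd h.1) ⟨i.1, i.2.succ⟩
      · rw [segmentMap_one]
        exact congrFun (congrArg Prod.snd h.2) ⟨i.1, i.2.succ⟩)
  refine ⟨E₁, E₂, i₁, i₂, fd₁, fd₂, ψ₀, ψ₁, ?_⟩
  -- both algebras embed into the same algebra, with the same image
  let α : C(I, ∀ j, M j) × F₁ →⋆ₙₐ[ℂ] C(I, ∀ i : (Σ j, Fin (m j + 1)), M i.1) ×
      (F₁ × (∀ y : (Σ j, Fin (m j + 2)), M y.1)) :=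
    ((piecesHom t U hU').comp (NonUnitalStarAlgHom.fst ℂ _ _)).prod
      ((NonUnitalStarAlgHom.snd ℂ _ _).prod
        ((evalPointsHom t).comp (NonUnitalStarAlgHom.fst ℂ _ _)))
  let β : C(I, E₂) × E₁ →⋆ₙₐ[ℂ] C(I, ∀ i : (Σ j, Fin (m j + 1)), M i.1) ×
      (F₁ × (∀ y : (Σ j, Fin (m j + 2)), M y.1)) :=
    ((postcompHom ι₂ hι₂.continuous).comp (NonUnitalStarAlgHom.fst ℂ _ _)).prod
      (ι₁.comp (NonUnitalStarAlgHom.snd ℂ _ _))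
  have hconj_inj : ∀ s x y, conjHom (U s) (hU' s) x = conjHom (U s) (hU' s) y → x = y := by
    intro s x y hxy
    have h2 : ∀ x, U s * conjHom (U s) (hU' s) x * star (U s) = x := fun x => by
      change U s * (star (U s) * x * U s) * star (U s) = x
      rw [mul_assoc, mul_assoc, mul_assoc, hU', mul_one, ← mul_assoc, hU', one_mul]
    rw [← h2 x, hxy, h2]
  have hα : Function.Injective α := by
    rintro ⟨f, g⟩ ⟨f', g'⟩ h
    obtain ⟨h1, h2⟩ := Prod.mk.inj h
    obtain ⟨h2, -⟩ := Prod.mk.inj h2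
    refine Prod.ext ?_ h2
    ext1 u
    funext j
    obtain ⟨l, s, rfl⟩ := exists_segmentMap_partition_eq (ht0 j) (ht1 j) u
    have h3 : piecesHom t U hU' f s = piecesHom t U hU' f' s := DFunLike.congr_fun h1 s
    exact congrFun (hconj_inj s _ _ h3) ⟨j, l⟩
  have hβ : Function.Injective β := by
    rintro ⟨f, g⟩ ⟨f', g'⟩ h
    obtain ⟨h1, h2⟩ := Prod.mk.inj h
    refine Prod.ext ?_ (hι₁.injective h2)
    ext1 u
    exact hι₂.injective (DFunLike.congr_fun h1 u)
  refine nonempty_starAlgEquiv (X := D) (Y := ETBlockSubalg E₁ E₂ ψ₀ ψ₁)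
    (Z := C(I, ∀ i : (Σ j, Fin (m j + 1)), M i.1) × (F₁ × (∀ y : (Σ j, Fin (m j + 2)), M y.1)))
    (α.comp (NonUnitalStarSubalgebraClass.subtype D))
    (β.comp (NonUnitalStarSubalgebraClass.subtype (ETBlockSubalg E₁ E₂ ψ₀ ψ₁)))
    (hα.comp Subtype.val_injective) (hβ.comp Subtype.val_injective) ?_ ?_
  · rintro ⟨⟨f, g⟩, hx⟩
    obtain ⟨⟨hf0, hf1⟩, hfP, hg, hg'⟩ := (hD _).1 hx
    obtain ⟨x₁, hx₁⟩ := (hS₁ (g, evalPointsHom (M := M) t f)).1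
      ⟨⟨Prod.ext hg (funext fun y => (hfP _ _).1), Prod.ext hg' (funext fun y => (hfP _ _).2)⟩,
        fun j => by
          change f (t j 0) j = φ₀ g j ∧ f (t j (Fin.last _)) j = φ₁ g j
          rw [ht0, ht1]
          exact ⟨congrFun hf0 j, congrFun hf1 j⟩⟩
    have hH : ∀ s, ∃ y, ι₂ y = piecesHom t U hU' f s := fun s =>
      hconj s _ (fun i => (hfP _ _).1) (fun i => (hfP _ _).2)
    choose H hH using hH
    have hHc : Continuous H := by
      rw [hι₂.isEmbedding.continuous_iff]
      exact (piecesHom t U hU' f).continuous.congr fun s => (hH s).symm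
    refine ⟨⟨(⟨H, hHc⟩, x₁), ?_, ?_⟩, Prod.ext (ContinuousMap.ext hH) hx₁⟩
    · refine hι₂.injective ?_
      rw [hψ₀]
      refine (hH 0).trans (congrArg (conjHom (U 0) (hU' 0)) (funext fun i => ?_))
      change f _ _ = (ι₁ x₁).2 ⟨i.1, i.2.castSucc⟩
      rw [hx₁, segmentMap_zero]
      rfl
    · refine hι₂.injective ?_
      rw [hψ₁]
      refine (hH 1).trans (congrArg (conjHom (U 1) (hU' 1)) (funext fun i => ?_))
      change f _ _ = (ι₁ x₁).2 ⟨i.1, i.2.succ⟩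
      rw [hx₁, segmentMap_one]
      rfl
  · rintro ⟨⟨F, x₁⟩, hF0, hF1⟩
    replace hF0 : F 0 = ψ₀ x₁ := hF0
    replace hF1 : F 1 = ψ₁ x₁ := hF1
    obtain ⟨⟨hx, hx'⟩, hxb⟩ := hS₁' x₁
    let G : C(I, ∀ i : (Σ j, Fin (m j + 1)), M i.1) :=
      ⟨fun s => U s * ι₂ (F s) * star (U s), by
        have := hι₂.continuous
        fun_prop⟩
    have hGconj : ∀ s x, ι₂ (F s) = conjHom (U s) (hU' s) x → G s = x := by
      intro s x h
      change U s * ι₂ (F s) * star (U s) = x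
      rw [h]
      change U s * (star (U s) * x * U s) * star (U s) = x
      rw [mul_assoc, mul_assoc, mul_assoc, hU', mul_one, ← mul_assoc, hU', one_mul]
    have hconjG : ∀ s, conjHom (U s) (hU' s) (G s) = ι₂ (F s) := by
      intro s
      change star (U s) * (U s * ι₂ (F s) * star (U s)) * U s = ι₂ (F s)
      rw [mul_assoc, mul_assoc, mul_assoc, hU, mul_one, ← mul_assoc, hU, one_mul]
    have hQG : ∀ s, Q s * G s = G s := fun s => by
      change Q s * (U s * ι₂ (F s) * star (U s)) = U s * ι₂ (F s) * star (U s)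
      rw [← mul_assoc, ← mul_assoc, ← hUQ, mul_assoc (U s), (hS₂' (F s)).1]
    have hGQ : ∀ s, G s * Q s = G s := fun s => by
      change U s * ι₂ (F s) * star (U s) * Q s = U s * ι₂ (F s) * star (U s)
      rw [mul_assoc, ← hUQ', ← mul_assoc, mul_assoc (U s), (hS₂' (F s)).2]
    have hG0 := hGconj 0 _ ((congrArg ι₂ hF0).trans (hψ₀ x₁))
    have hG1 := hGconj 1 _ ((congrArg ι₂ hF1).trans (hψ₁ x₁))
    have hglue : ∀ j, ∃ f : C(I, M j), ∀ l s,
        f (segmentMap (t j l.castSucc) (t j l.succ) s) = G s ⟨j, l⟩ := fun j =>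
      exists_glue (X := M j) (ht j) (ht0 j) (ht1 j)
        (fun l => ⟨fun s => G s ⟨j, l⟩, by fun_prop⟩) (fun l => (ι₁ x₁).2 ⟨j, l⟩)
        (fun l => congrFun hG0 ⟨j, l⟩) (fun l => congrFun hG1 ⟨j, l⟩)
    choose f hf using hglue
    have hft : ∀ j l, f j (t j l) = (ι₁ x₁).2 ⟨j, l⟩ := by
      intro j l
      induction l using Fin.lastCases with
      | last =>
        have := hf j (Fin.last _) 1
        rw [segmentMap_one] at this
        exact this.trans (congrFun hG1 ⟨j, Fin.last _⟩)
      | cast l =>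
        have := hf j l 0
        rw [segmentMap_zero] at this
        exact this.trans (congrFun hG0 ⟨j, l⟩)
    refine ⟨⟨(⟨fun s j => f j s, by fun_prop⟩, (ι₁ x₁).1), (hD _).2 ⟨⟨?_, ?_⟩, ?_, ?_, ?_⟩⟩,
      Prod.ext (ContinuousMap.ext fun s => ?_) (Prod.ext rfl (funext fun y => hft y.1 y.2))⟩
    · funext j
      have := hft j 0
      rw [ht0] at this
      exact this.trans (hxb j).1
    · funext j
      have := hft j (Fin.last _)
      rw [ht1] at this
      exact this.trans (hxb j).2
    · intro j u
      obtain ⟨l, s, rfl⟩ := exists_segmentMap_partition_eq (ht0 j) (ht1 j) u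
      change P j _ * f j _ = f j _ ∧ f j _ * P j _ = f j _
      rcases eq_or_ne s 0 with rfl | hs0
      · rw [segmentMap_zero, hft]
        exact ⟨congrFun (congrArg Prod.snd hx) ⟨j, l.castSucc⟩,
          congrFun (congrArg Prod.snd hx') ⟨j, l.castSucc⟩⟩
      rcases eq_or_ne s 1 with rfl | hs1
      · rw [segmentMap_one, hft]
        exact ⟨congrFun (congrArg Prod.snd hx) ⟨j, l.succ⟩,
          congrFun (congrArg Prod.snd hx') ⟨j, l.succ⟩⟩
      have hs : s ∈ Set.Ioo (0 : I) 1 :=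
        ⟨lt_of_le_of_ne bot_le hs0.symm, lt_of_le_of_ne le_top hs1⟩
      rw [hf, ← hQP' s hs ⟨j, l⟩]
      exact ⟨congrFun (hQG s) ⟨j, l⟩, congrFun (hGQ s) ⟨j, l⟩⟩
    · exact congrArg Prod.fst hx
    · exact congrArg Prod.fst hx'
    · refine Eq.trans (congrArg (conjHom (U s) (hU' s)) (funext fun i => ?_)) (hconjG s)
      exact hf i.1 i.2 s

end Core

lemma isClosed_setOf_isStarProjection (A : Type*) [CStarAlgebra A] :
    IsClosed {q : A | IsStarProjection q} := by
  simp only [isStarProjection_iff, isSelfAdjoint_iff, IsIdempotentElem]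
  exact (isClosed_eq (by fun_prop) continuous_id).inter (isClosed_eq continuous_star continuous_id)

/-- A path of projections which is continuous on an open interval and has limits at the ends
which dominate it extends to a continuous path of projections on the closed interval. -/
lemma exists_continuousMap_isStarProjection {r : ℕ} {P : I → MatAlg r}
    (hP : ∀ s, IsStarProjection (P s)) {a b : I} (hab : a < b)
    (hc : ContinuousOn P (Set.Ioo a b)) {la lb : MatAlg r}
    (ha : Filter.Tendsto P (nhdsWithin a (Set.Ioi a)) (nhds la))
    (hb : Filter.Tendsto P (nhdsWithin b (Set.Iio b)) (nhds lb))
    (hla : (la - P a).IsPositive) (hlb : (lb - P b).IsPositive) :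
    ∃ Q : C(I, MatAlg r), (∀ s, IsStarProjection (Q s)) ∧
      (∀ s, Q s * P (segmentMap a b s) = P (segmentMap a b s)) ∧
      ∀ s ∈ Set.Ioo (0 : I) 1, Q s = P (segmentMap a b s) := by
  have hm := strictMono_segmentMap hab
  have hmem : ∀ s, segmentMap a b s ∈ Set.Icc a b := fun s => by
    have h0 := hm.monotone (show 0 ≤ s from bot_le)
    have h1 := hm.monotone (show s ≤ 1 from le_top)
    rw [segmentMap_zero] at h0
    rw [segmentMap_one] at h1
    exact ⟨h0, h1⟩
  have hmem' : ∀ s ∈ Set.Ioo (0 : I) 1, segmentMap a b s ∈ Set.Ioo a b := fun s hs => by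
    have h0 := hm hs.1
    have h1 := hm hs.2
    rw [segmentMap_zero] at h0
    rw [segmentMap_one] at h1
    exact ⟨h0, h1⟩
  have hcont := (continuousOn_Icc_extendFrom_Ioo hc ha hb).comp_continuous
    (segmentMap a b).continuous hmem
  have hext : ∀ s ∈ Set.Ioo (0 : I) 1,
      extendFrom (Set.Ioo a b) P (segmentMap a b s) = P (segmentMap a b s) := fun s hs =>
    extendFrom_extends hc _ (hmem' s hs)
  have hdom : ∀ {q q' : MatAlg r}, IsStarProjection q → IsStarProjection q' →
      (q - q').IsPositive → q * q' = q' := fun hq hq' h =>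
    (hq'.le_iff_mul_eq_right hq).1 h
  have : (nhdsWithin a (Set.Ioi a)).NeBot := nhdsGT_neBot_of_exists_gt ⟨b, hab⟩
  have : (nhdsWithin b (Set.Iio b)).NeBot := nhdsLT_neBot_of_exists_lt ⟨a, hab⟩
  have hpa : IsStarProjection la :=
    (isClosed_setOf_isStarProjection (MatAlg r)).mem_of_tendsto ha (.of_forall hP)
  have hpb : IsStarProjection lb :=
    (isClosed_setOf_isStarProjection (MatAlg r)).mem_of_tendsto hb (.of_forall hP)
  have cases01 : ∀ s : I, s = 0 ∨ s = 1 ∨ s ∈ Set.Ioo (0 : I) 1 := fun s => by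
    rcases eq_or_ne s 0 with h0 | h0
    · exact .inl h0
    rcases eq_or_ne s 1 with h1 | h1
    · exact .inr (.inl h1)
    exact .inr (.inr ⟨lt_of_le_of_ne bot_le h0.symm, lt_of_le_of_ne le_top h1⟩)
  refine ⟨⟨_, hcont⟩, fun s => ?_, fun s => ?_, hext⟩
  · change IsStarProjection (extendFrom (Set.Ioo a b) P (segmentMap a b s))
    rcases cases01 s with rfl | rfl | hs
    · rwa [segmentMap_zero, eq_lim_at_left_extendFrom_Ioo hab ha]
    · rwa [segmentMap_one, eq_lim_at_right_extendFrom_Ioo hab hb]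
    · rw [hext s hs]
      exact hP _
  · change extendFrom (Set.Ioo a b) P (segmentMap a b s) * _ = _
    rcases cases01 s with rfl | rfl | hs
    · rw [segmentMap_zero, eq_lim_at_left_extendFrom_Ioo hab ha]
      exact hdom hpa (hP a) hla
    · rw [segmentMap_one, eq_lim_at_right_extendFrom_Ioo hab hb]
      exact hdom hpb (hP b) hlb
    · rw [hext s hs]
      exact (hP _).isIdempotentElem

lemma IsRangeProjection.isStarProjection {A : Type*} [NonUnitalSemiring A] [StarRing A]
    {x p : A} (h : IsRangeProjection x p) : IsStarProjection p :=
  ⟨h.2.1, h.1⟩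

/-- If `(h, a)` is a positive element of the Elliott–Thomsen building block
`B = A(F₁, ⊕ⱼ M_{r j}, φ₀, φ₁)` whose range projections `t ↦ P j t` satisfy the partition
conditions (1)–(4), then the hereditary C⋆-subalgebra `closure ((h,a) B (h,a))` is
*-isomorphic to an Elliott–Thomsen building block `A(E₁, E₂, ψ₀, ψ₁)` for some
finite-dimensional C⋆-algebras `E₁`, `E₂`. -/
theorem statement2
    {F₁ : Type} [CStarAlgebra F₁] [FiniteDimensional ℂ F₁]
    {k : ℕ} (r : Fin k → ℕ)
    (φ₀ φ₁ : F₁ →⋆ₙₐ[ℂ] (∀ j : Fin k, MatAlg (r j)))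
    (h : C(I, ∀ j : Fin k, MatAlg (r j))) (a : F₁)
    (hmem : (h, a) ∈ ETBlockSubalg F₁ (∀ j : Fin k, MatAlg (r j)) φ₀ φ₁)
    (hpos : ∃ s : C(I, ∀ j : Fin k, MatAlg (r j)) × F₁, (h, a) = star s * s)
    (hsa : star ((h, a) : C(I, ∀ j : Fin k, MatAlg (r j)) × F₁) = (h, a))
    (P : ∀ j : Fin k, I → MatAlg (r j))
    (hP : ∀ (j : Fin k) (t : I), IsRangeProjection (h t j) (P j t))
    (p : F₁) (hp : IsRangeProjection a p)
    (hcond : RangeProjPartitionCond r P (φ₀ p) (φ₁ p)) :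
    ∃ (E₁ E₂ : Type) (i₁ : CStarAlgebra E₁) (i₂ : CStarAlgebra E₂),
      letI := i₁; letI := i₂;
      ∃ (_ : FiniteDimensional ℂ E₁) (_ : FiniteDimensional ℂ E₂)
        (ψ₀ ψ₁ : E₁ →⋆ₙₐ[ℂ] E₂),
        Nonempty
          ((heredSubalg (ETBlockSubalg F₁ (∀ j : Fin k, MatAlg (r j)) φ₀ φ₁) (h, a) hmem hsa)
            ≃⋆ₐ[ℂ] (ETBlockSubalg E₁ E₂ ψ₀ ψ₁)) := by
  choose m t Pp Pm ht ht0 ht1 hc hPp hPm hdp hdm h0 h1 using hcond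
  have hPproj : ∀ j s, IsStarProjection (P j s) := fun j s => (hP j s).isStarProjection
  have hlt : ∀ j (l : Fin (m j + 1)), t j l.castSucc < t j l.succ := fun j l =>
    ht j l.castSucc_lt_succ
  have hlt1 : ∀ j (l : Fin (m j + 1)), t j l.castSucc < 1 := fun j l =>
    (hlt j l).trans_le le_top
  have hgt0 : ∀ j (l : Fin (m j + 1)), 0 < t j l.succ := fun j l =>
    lt_of_le_of_lt bot_le (hlt j l)
  have hQ : ∀ i : (Σ j, Fin (m j + 1)), _ := fun i =>
    exists_continuousMap_isStarProjection (hPproj i.1) (hlt i.1 i.2) (hc i.1 i.2).1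
      (hPp _ _ (hlt1 _ _)) (hPm _ _ (hgt0 _ _)) (hdp _ _ (hlt1 _ _)) (hdm _ _ (hgt0 _ _))
  choose Q hQ hQP hQP' using hQ
  have hsa₁ : ∀ s j, IsSelfAdjoint (h s j) := fun s j =>
    congrFun (DFunLike.congr_fun (congrArg Prod.fst hsa) s) j
  have hunit : ∀ s, IsRangeUnit (h s) (fun j => P j s) := fun s => by
    have hy := fun j => (hP j s).exists_eq_mul (hsa₁ s j)
    choose y hy using hy
    exact ⟨funext fun j => (hP j s).1, funext fun j => (hP j s).2.2.1, y, funext hy⟩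
  have hunit' : IsRangeUnit a p :=
    ⟨hp.1, hp.2.2.1, hp.exists_eq_mul (congrArg Prod.snd hsa)⟩
  refine nonempty_starAlgEquiv_ETBlockSubalg φ₀ φ₁ P p hp.isStarProjection hPproj
    (fun j => (h0 j).1) (fun j => (h1 j).1) _ (fun x => ?_) t ht ht0 ht1
    ⟨fun s i => Q i s, by fun_prop⟩
    (fun s => ⟨funext fun i => (hQ i s).isIdempotentElem, funext fun i => (hQ i s).isSelfAdjoint⟩)
    (fun s i => hQP i s) (fun s hs i => hQP' i s hs)
  rw [mem_heredSubalg_ETBlockSubalg_iff hmem hsa hpos hunit hunit']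
  refine and_congr_right fun _ => and_congr_left fun _ => ⟨fun hx j s => ?_, fun hx s => ?_⟩
  · exact ⟨congrFun (hx s).1 j, congrFun (hx s).2 j⟩
  · exact ⟨funext fun j => (hx j s).1, funext fun j => (hx j s).2⟩
end
end

section
/- Let n ≥ 1 and let a₁, a₂, …, aₙ be nonzero integers such that at least one of them is positive and at least one of them is negative. Then for every integer d, if the equation a₁x₁ + a₂x₂ + ⋯ + aₙxₙ = d has a solution in integers x₁, …, xₙ, then it has a solution in which every xᵢ is a positive integer (xᵢ ≥ 1 for all i). -/
/-- A family of integers taking both signs is orthogonal to a family of positive integers. -/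
theorem exists_one_le_sum_mul_eq_zero {ι : Type*} [Fintype ι] (a : ι → ℤ)
    (hpos : ∃ i, 0 < a i) (hneg : ∃ i, a i < 0) :
    ∃ y : ι → ℤ, (∀ i, 1 ≤ y i) ∧ ∑ i, a i * y i = 0 := by
  obtain ⟨p, hp⟩ := hpos
  obtain ⟨q, hq⟩ := hneg
  set P : ℤ := ∑ i, max (a i) 0 with hP
  set N : ℤ := ∑ i, max (-a i) 0 with hN
  have hP1 : 1 ≤ P := by
    have := Finset.single_le_sum (f := fun i => max (a i) 0)
      (fun i _ => le_max_right _ _) (Finset.mem_univ p)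
    grind
  have hN1 : 1 ≤ N := by
    have := Finset.single_le_sum (f := fun i => max (-a i) 0)
      (fun i _ => le_max_right _ _) (Finset.mem_univ q)
    grind
  refine ⟨fun i => if 0 < a i then N else P, fun i => by dsimp only; split_ifs <;> assumption, ?_⟩
  calc ∑ i, a i * (if 0 < a i then N else P)
      = ∑ i, (max (a i) 0 * N - max (-a i) 0 * P) := by
        refine Finset.sum_congr rfl fun i _ => ?_
        split_ifs with h
        · rw [max_eq_left h.le, max_eq_right (by lia)]
          ring
        · rw [max_eq_right (not_lt.mp h), max_eq_left (by lia)]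
          ring
    _ = 0 := by
        rw [Finset.sum_sub_distrib, ← Finset.sum_mul, ← Finset.sum_mul, ← hP, ← hN]
        ring

/-- **Positive solutions of linear Diophantine equations.**
Let `a 1, …, a n` be nonzero integers, at least one positive and at least one negative.
Then for every integer `d`, if `∑ i, a i * x i = d` has an integer solution, it has a solution
consisting of positive integers (`1 ≤ x i` for all `i`). -/
theorem exists_positive_integer_solution_of_exists_integer_solution
    (n : ℕ) (hn : 1 ≤ n) (a : Fin n → ℤ) (ha : ∀ i, a i ≠ 0)
    (hpos : ∃ i, 0 < a i) (hneg : ∃ i, a i < 0) (d : ℤ)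
    (hsol : ∃ x : Fin n → ℤ, ∑ i, a i * x i = d) :
    ∃ x : Fin n → ℤ, (∀ i, 1 ≤ x i) ∧ ∑ i, a i * x i = d := by
  obtain ⟨x, hx⟩ := hsol
  obtain ⟨y, hy, hay⟩ := exists_one_le_sum_mul_eq_zero a hpos hneg
  refine ⟨fun i => x i + (∑ j, |x j| + 1) * y i, fun i => ?_, ?_⟩
  · have hi : |x i| ≤ ∑ j, |x j| :=
      Finset.single_le_sum (f := fun j => |x j|) (fun j _ => abs_nonneg _) (Finset.mem_univ i)
    have h := neg_abs_le (x i)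
    have h' := abs_nonneg (x i)
    nlinarith [hy i]
  · simp only [mul_add, mul_left_comm (a _), Finset.sum_add_distrib, ← Finset.mul_sum, hx, hay,
      mul_zero, add_zero]
end

section
/- For every ε > 0 there exists δ > 0 with the following property: for every C*-algebra A, every positive element e ∈ A with ‖e‖ ≤ 1, and every a ∈ A with ‖a‖ ≤ 1, if ‖e·a − a·e‖ < δ then ‖e^{1/2}·a·e^{1/2} − e·a‖ < ε. (The choice of δ depends only on ε and not on the C*-algebra A or the elements e and a.) -/
/-- The commutator of `b` with a power of a contraction `x` is controlled by `x * b - b * x`. -/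
theorem norm_pow_mul_sub_mul_pow_le {B : Type*} [NormedRing B] {x b : B} (hx : ‖x‖ ≤ 1) (n : ℕ) :
    ‖x ^ n * b - b * x ^ n‖ ≤ n * ‖x * b - b * x‖ := by
  induction n with
  | zero => simp
  | succ n ih =>
    have hcomm : x ^ (n + 1) * b - b * x ^ (n + 1) =
        x * (x ^ n * b - b * x ^ n) + (x * b - b * x) * x ^ n := by
      rw [pow_succ']; noncomm_ring
    have hpow : ‖(x * b - b * x) * x ^ n‖ ≤ ‖x * b - b * x‖ := by
      rcases n.eq_zero_or_pos with rfl | hn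
      · simp
      · exact (norm_mul_le _ _).trans (mul_le_of_le_one_right (norm_nonneg _)
          ((norm_pow_le' x hn).trans (pow_le_one₀ (norm_nonneg _) hx)))
    have hmul : ‖x * (x ^ n * b - b * x ^ n)‖ ≤ ‖x ^ n * b - b * x ^ n‖ :=
      (norm_mul_le _ _).trans (mul_le_of_le_one_left (norm_nonneg _) hx)
    rw [hcomm]
    push_cast
    linarith [norm_add_le (x * (x ^ n * b - b * x ^ n)) ((x * b - b * x) * x ^ n)]

open Polynomial in
/-- The commutator of `b` with `p(x)`, for `x` a contraction, is controlled by `x * b - b * x`,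
with a constant that depends only on the polynomial `p`. -/
theorem Polynomial.exists_forall_norm_aeval_mul_sub_mul_aeval_le (p : ℝ[X]) :
    ∃ C : ℝ, 0 ≤ C ∧ ∀ (B : Type) [NormedRing B] [NormedAlgebra ℝ B], ∀ x b : B, ‖x‖ ≤ 1 →
      ‖aeval x p * b - b * aeval x p‖ ≤ C * ‖x * b - b * x‖ := by
  induction p using Polynomial.induction_on' with
  | add p q hp hq =>
    obtain ⟨C, hC, hp⟩ := hp
    obtain ⟨D, hD, hq⟩ := hq
    refine ⟨C + D, add_nonneg hC hD, fun B _ _ x b hx => ?_⟩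
    have hadd : aeval x (p + q) * b - b * aeval x (p + q) =
        (aeval x p * b - b * aeval x p) + (aeval x q * b - b * aeval x q) := by
      rw [map_add]; noncomm_ring
    rw [hadd, add_mul]
    exact norm_add_le_of_le (hp B x b hx) (hq B x b hx)
  | monomial n c =>
    refine ⟨|c| * n, by positivity, fun B _ _ x b hx => ?_⟩
    have hsmul : aeval x (monomial n c) * b - b * aeval x (monomial n c) =
        c • (x ^ n * b - b * x ^ n) := by
      rw [aeval_monomial, ← Algebra.smul_def, smul_mul_assoc, mul_smul_comm, smul_sub]
    rw [hsmul, norm_smul, Real.norm_eq_abs, mul_assoc]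
    gcongr
    exact norm_pow_mul_sub_mul_pow_le hx n

open Polynomial in
/-- If `p` is within `η` of the square root on `[0, 1]` and `s` is self-adjoint with spectrum in
`[0, 1]`, then `p(s²)` is within `η` of `s`. -/
theorem norm_aeval_mul_self_sub_le {B : Type*} [CStarAlgebra B] {s : B} (hs : IsSelfAdjoint s)
    (hspec : spectrum ℝ s ⊆ Set.Icc 0 1) {p : ℝ[X]} {η : ℝ} (hη : 0 ≤ η)
    (hp : ∀ t ∈ Set.Icc (0 : ℝ) 1, |p.eval t - √t| ≤ η) :
    ‖aeval (s * s) p - s‖ ≤ η := by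
  have hcomp : aeval (s * s) p - s = cfc (p.comp (X * X) - X).eval s := by
    rw [cfc_polynomial _ s hs]
    simp [aeval_comp]
  rw [hcomp]
  refine norm_cfc_le hη fun t ht => ?_
  obtain ⟨h0, h1⟩ := hspec ht
  have h := hp (t * t) ⟨mul_nonneg h0 h0, mul_le_one₀ h1 h0 h1⟩
  rw [Real.sqrt_mul_self h0] at h
  simpa using h

/-- A positive contraction has real spectrum in `[0, 1]` in the unitization. -/
theorem Unitization.spectrum_inr_subset_Icc {A : Type*} [NonUnitalCStarAlgebra A] [PartialOrder A]
    [StarOrderedRing A] {s : A} (hs : 0 ≤ s) (hs1 : ‖s‖ ≤ 1) :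
    spectrum ℝ (s : Unitization ℂ A) ⊆ Set.Icc 0 1 := by
  intro t ht
  refine ⟨?_, ?_⟩
  · rw [← Unitization.quasispectrum_eq_spectrum_inr' ℝ ℂ] at ht
    exact quasispectrum_nonneg_of_nonneg _ hs t ht
  · have h := spectrum.norm_le_norm_of_mem ht
    rw [Unitization.norm_inr] at h
    exact (le_abs_self t).trans (h.trans hs1)

/-- The commutator of a contraction `a` with a positive contraction `s` is small as soon as the
commutator of `a` with `s * s` is, uniformly over all C⋆-algebras. -/
theorem exists_delta_forall_norm_mul_sub_mul_lt (ε : ℝ) (hε : 0 < ε) :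
    ∃ δ : ℝ, 0 < δ ∧
      ∀ (A : Type) [NonUnitalCStarAlgebra A] [PartialOrder A] [StarOrderedRing A],
        ∀ s a : A, 0 ≤ s → ‖s‖ ≤ 1 → ‖a‖ ≤ 1 → ‖s * s * a - a * (s * s)‖ < δ →
          ‖a * s - s * a‖ < ε := by
  obtain ⟨p, hp⟩ := exists_polynomial_near_of_continuousOn 0 1 Real.sqrt
    Real.continuous_sqrt.continuousOn (ε / 4) (by positivity)
  obtain ⟨C, hC, hcomm⟩ := p.exists_forall_norm_aeval_mul_sub_mul_aeval_le
  refine ⟨ε / (2 * (C + 1)), by positivity, fun A _ _ _ s a hs hs1 ha hδ => ?_⟩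
  have hCδ : C * ‖s * s * a - a * (s * s)‖ < ε / 2 := by
    rw [lt_div_iff₀ (by positivity)] at hδ
    nlinarith [norm_nonneg (s * s * a - a * (s * s))]
  have hnear := norm_aeval_mul_self_sub_le (hs.isSelfAdjoint.inr ℂ)
    (Unitization.spectrum_inr_subset_Icc hs hs1) (by positivity) fun t ht => (hp t ht).le
  obtain ⟨S, hS⟩ : ∃ S : Unitization ℂ A, S = Unitization.inr s := ⟨_, rfl⟩
  obtain ⟨b, hb⟩ : ∃ b : Unitization ℂ A, b = Unitization.inr a := ⟨_, rfl⟩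
  have hS1 : ‖S‖ ≤ 1 := by rwa [hS, Unitization.norm_inr]
  have hb1 : ‖b‖ ≤ 1 := by rwa [hb, Unitization.norm_inr]
  have hpS := hcomm (Unitization ℂ A) (S * S) b
    ((norm_mul_le _ _).trans (mul_le_one₀ hS1 (norm_nonneg _) hS1))
  have hinr : ‖S * S * b - b * (S * S)‖ = ‖s * s * a - a * (s * s)‖ := by
    rw [hS, hb, ← Unitization.norm_inr (𝕜 := ℂ) (s * s * a - a * (s * s))]
    simp only [Unitization.inr_sub, Unitization.inr_mul]
  rw [hinr] at hpS
  rw [← hS] at hnear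
  generalize Polynomial.aeval (S * S) p = P at hnear hpS
  have hleft : ‖(P - S) * b‖ ≤ ε / 4 :=
    (norm_mul_le _ _).trans ((mul_le_of_le_one_right (norm_nonneg _) hb1).trans hnear)
  have hright : ‖b * (P - S)‖ ≤ ε / 4 :=
    (norm_mul_le _ _).trans ((mul_le_of_le_one_left (norm_nonneg _) hb1).trans hnear)
  have heq : b * S - S * b = (P - S) * b - b * (P - S) - (P * b - b * P) := by
    noncomm_ring
  have hnorm : ‖a * s - s * a‖ = ‖b * S - S * b‖ := by
    rw [hS, hb, ← Unitization.norm_inr (𝕜 := ℂ) (a * s - s * a)]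
    simp only [Unitization.inr_sub, Unitization.inr_mul]
  rw [hnorm, heq]
  linarith [norm_sub_le ((P - S) * b - b * (P - S)) (P * b - b * P),
    norm_sub_le ((P - S) * b) (b * (P - S))]


/-- For every `ε > 0` there exists a `δ > 0`, depending only on `ε`, such that for **every**
C⋆-algebra `A` (equipped with its canonical partial order, so that it is a `StarOrderedRing`),
every positive element `e` of norm at most `1` and every `a` of norm at most `1`:
if `‖e * a - a * e‖ < δ` then `‖e ^ (1/2) * a * e ^ (1/2) - e * a‖ < ε`,
where `e ^ (1/2) = CFC.sqrt e` is the unique positive square root of `e`. -/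
theorem exists_delta_forall_cstarAlgebra_norm_sqrt_mul_sqrt_sub_mul_lt
    (ε : ℝ) (hε : 0 < ε) :
    ∃ δ : ℝ, 0 < δ ∧
      ∀ (A : Type) [NonUnitalCStarAlgebra A] [PartialOrder A] [StarOrderedRing A],
        ∀ e a : A, 0 ≤ e → ‖e‖ ≤ 1 → ‖a‖ ≤ 1 → ‖e * a - a * e‖ < δ →
          ‖CFC.sqrt e * a * CFC.sqrt e - e * a‖ < ε := by
  obtain ⟨δ, hδ, hcomm⟩ := exists_delta_forall_norm_mul_sub_mul_lt ε hε
  refine ⟨δ, hδ, fun A _ _ _ e a he he1 ha hea => ?_⟩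
  have hss : CFC.sqrt e * CFC.sqrt e = e := CFC.sqrt_mul_sqrt_self e he
  have hs1 : ‖CFC.sqrt e‖ ≤ 1 := by
    have h := CStarRing.norm_star_mul_self (x := CFC.sqrt e)
    rw [(CFC.sqrt_nonneg e).isSelfAdjoint.star_eq, hss] at h
    nlinarith [norm_nonneg (CFC.sqrt e)]
  have hsqrt := hcomm A (CFC.sqrt e) a (CFC.sqrt_nonneg e) hs1 ha (by rwa [hss])
  have hfactor : CFC.sqrt e * a * CFC.sqrt e - e * a =
      CFC.sqrt e * (a * CFC.sqrt e - CFC.sqrt e * a) := by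
    rw [mul_sub, ← mul_assoc, ← mul_assoc, hss]
  rw [hfactor]
  exact (norm_mul_le _ _).trans_lt ((mul_le_of_le_one_left (norm_nonneg _) hs1).trans_lt hsqrt)
end
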